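/- Let f be a real polynomial of degree d, let a_j ± i b_j (b_j > 0), j = 1, …, d_E, be the non-real roots of Df, and define the critical intervals E_j = [a_j − 2b_j, a_j + 2b_j]. Let λ > 1 and κ ∈ (0, 1/(13√d_E)), and let J ⊂ T be intervals such that T equals the δ-scaled neighbourhood of J, f restricted to T is a diffeomorphism, and |T ∩ E_j| < κ|E_j|/λ for all j = 1, …, d_E. Assume moreover that either the interval λT contains a (real) critical point of f, or there exists j₀ ∈ {1, …, d_E} with T ⊄ 2E_{j₀} and λT ∩ E_{j₀} ≠ ∅. Then B(f, T, J) > 1 + (1/12)(16/(17(1+λ)²) − 32 κ² d_E / λ²) · 1/(1+2δ)². -/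

import Mathlib

open Set Filter Topology MeasureTheory

noncomputable section

/-- The length of a set of reals (its Lebesgue measure). -/
def slen (S : Set ℝ) : ℝ := (volume S).toReal

/-- The cross-ratio `D(T,J)` for intervals `T = [t1,t2] ⊇ J = [j1,j2]`. -/
def crossRatio (t1 j1 j2 t2 : ℝ) : ℝ :=
  ((t2 - t1) * (j2 - j1)) / ((j1 - t1) * (t2 - j2))

/-- The cross-ratio distortion `B(f,T,J)` for `T = [t1,t2] ⊇ J = [j1,j2]`. -/
def crDist (f : ℝ → ℝ) (t1 j1 j2 t2 : ℝ) : ℝ :=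
  crossRatio (f t1) (f j1) (f j2) (f t2) / crossRatio t1 j1 j2 t2

/-- The Schwarzian derivative of `f`. -/
def schwarzian (f : ℝ → ℝ) (x : ℝ) : ℝ :=
  iteratedDeriv 3 f x / deriv f x - (3 / 2) * (iteratedDeriv 2 f x / deriv f x) ^ 2

/-- The `l`-scaling `lI` of the interval `I` with endpoints `x ≤ y`
(same centre, half-width multiplied by `l`). -/
def scaledIcc (l x y : ℝ) : Set ℝ :=
  Icc ((x + y) / 2 - l * (y - x) / 2) ((x + y) / 2 + l * (y - x) / 2)

/-- The `l`-scaling of a bounded interval given as a set. -/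
def scaledSet (l : ℝ) (S : Set ℝ) : Set ℝ := scaledIcc l (sInf S) (sSup S)

/-- `p` is a periodic point of `g` of (exact) period `n`. -/
def PeriodicPt (g : ℝ → ℝ) (p : ℝ) (n : ℕ) : Prop :=
  0 < n ∧ g^[n] p = p ∧ ∀ m, 0 < m → m < n → g^[m] p ≠ p

/-- The forward orbit of `p` under `g`. -/
def orbitSet (g : ℝ → ℝ) (p : ℝ) : Set ℝ := Set.range fun k => g^[k] p

/-- The iterates of `x` converge to the set `O`. -/
def ConvergesToOrbit (g : ℝ → ℝ) (x : ℝ) (O : Set ℝ) : Prop :=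
  Tendsto (fun k => Metric.infDist (g^[k] x) O) atTop (nhds 0)

/-- The basin of attraction of the set `O`. -/
def Basin (g : ℝ → ℝ) (O : Set ℝ) : Set ℝ := {x | ConvergesToOrbit g x O}

/-- The immediate basin of attraction of `O` within `N`: the union of the connected
components of the basin which contain points of `O`. -/
def ImmBasinIn (g : ℝ → ℝ) (N : Set ℝ) (O : Set ℝ) : Set ℝ :=
  ⋃ y ∈ O, connectedComponentIn (Basin g O ∩ N) y

/-- `p` is an attracting periodic point of period `n` for the map `g : N → N`. -/
def AttractingIn (g : ℝ → ℝ) (N : Set ℝ) (p : ℝ) (n : ℕ) : Prop :=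
  PeriodicPt g p n ∧
    ∃ U : Set ℝ, IsOpen U ∧ p ∈ U ∧ ∀ x ∈ U ∩ N, ConvergesToOrbit g x (orbitSet g p)

/-- `p` is a neutral periodic point of `g`. -/
def NeutralPeriodicPt (g : ℝ → ℝ) (p : ℝ) (n : ℕ) : Prop :=
  0 < n ∧ g^[n] p = p ∧ |deriv (g^[n]) p| = 1

/-- `g` is `η`-close to `f` in the `C^k` topology on `N`. -/
def CkClose (k : ℕ) (f g : ℝ → ℝ) (N : Set ℝ) (η : ℝ) : Prop :=
  ∀ i ≤ k, ∀ x ∈ N, |iteratedDeriv i g x - iteratedDeriv i f x| ≤ η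

/-- `{T k}_{k=0}^m` is a chain for the map `g : N → N`:
each `T k` is a connected component of `g⁻¹(T (k+1))` (within `N`). -/
def IsChainIn (g : ℝ → ℝ) (N : Set ℝ) (m : ℕ) (T : ℕ → Set ℝ) : Prop :=
  ∀ k < m, (T k).Nonempty ∧ ∀ x ∈ T k, T k = connectedComponentIn (g ⁻¹' T (k + 1) ∩ N) x

/-- `[u,v]` is a periodic interval of period `n` for `g`. -/
def IsPeriodicInterval (g : ℝ → ℝ) (u v : ℝ) (n : ℕ) : Prop :=
  u ≤ v ∧ 0 < n ∧ g^[n] '' Icc u v = Icc u v ∧ InjOn (g^[n]) (Icc u v)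

/-- The periodic points of `g` lying in `S`. -/
def periodicPtsIn (g : ℝ → ℝ) (S : Set ℝ) : Set ℝ :=
  {x ∈ S | ∃ m : ℕ, 0 < m ∧ g^[m] x = x}

/-- A pack of periodic points of `g`: the set of all periodic points in some closed
(possibly degenerate) periodic interval such that no larger periodic interval
contains more periodic points. -/
def IsPack (g : ℝ → ℝ) (P : Set ℝ) : Prop :=
  ∃ u v n, IsPeriodicInterval g u v n ∧ P = periodicPtsIn g (Icc u v) ∧
    ∀ u' v' n', Icc u v ⊆ Icc u' v' → IsPeriodicInterval g u' v' n' →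
      periodicPtsIn g (Icc u' v') = P

/-- `f : N → N` has a wandering interval: a nondegenerate interval whose iterates are
pairwise disjoint and which is not contained in the basin of a periodic attractor. -/
def HasWanderingInterval (f : ℝ → ℝ) (N : Set ℝ) : Prop :=
  ∃ u v : ℝ, u < v ∧ Ioo u v ⊆ N ∧
    (∀ m n : ℕ, m ≠ n → Disjoint (f^[m] '' Ioo u v) (f^[n] '' Ioo u v)) ∧
    ¬ ∃ p ∈ N, ∃ k : ℕ, AttractingIn f N p k ∧
        ∀ x ∈ Ioo u v, ConvergesToOrbit f x (orbitSet f p)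

/-- `n` is the orientation preserving period of the periodic point `p`: it is `2m` if
`Dg^m(p) < 0` and `m` if `Dg^m(p) ≥ 0`, where `m` is the period of `p`. -/
def OrientationPreservingPeriod (g : ℝ → ℝ) (p : ℝ) (n : ℕ) : Prop :=
  ∃ m : ℕ, PeriodicPt g p m ∧
    ((deriv (g^[m]) p < 0 ∧ n = 2 * m) ∨ (0 ≤ deriv (g^[m]) p ∧ n = m))

/-- A function with nonnegative derivative on `[a, b]` satisfies `φ a ≤ φ b`. -/
lemma le_of_hasDerivAt_nonneg {φ φ' : ℝ → ℝ} {a b : ℝ} (hab : a ≤ b)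
    (hφ : ∀ t ∈ Icc a b, HasDerivAt φ (φ' t) t) (h0 : ∀ t ∈ Icc a b, 0 ≤ φ' t) :
    φ a ≤ φ b := by
  refine monotoneOn_of_hasDerivWithinAt_nonneg (f' := φ') (convex_Icc a b)
    (fun t ht => (hφ t ht).continuousAt.continuousWithinAt)
    (fun t ht => (hφ t (interior_subset ht)).hasDerivWithinAt)
    (fun t ht => h0 t (interior_subset ht)) (left_mem_Icc.2 hab) (right_mem_Icc.2 hab) hab

/-- If `u(x) = 0`, `u'(x) = r ≥ 0` and `u'' ≥ 6su` with `u ≥ 0`, then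
`u(y) ≥ r ((y - x) + s (y - x)³)`. -/
lemma cubic_le_of_second_deriv {u u' u'' : ℝ → ℝ} {x y r s : ℝ} (hxy : x ≤ y) (hs : 0 ≤ s)
    (hr : u' x = r) (hux : u x = 0)
    (hu : ∀ t ∈ Icc x y, HasDerivAt u (u' t) t)
    (hu' : ∀ t ∈ Icc x y, HasDerivAt u' (u'' t) t)
    (hpos : ∀ t ∈ Icc x y, 0 ≤ u t)
    (hconv : ∀ t ∈ Icc x y, 6 * s * u t ≤ u'' t) :
    r * ((y - x) + s * (y - x) ^ 3) ≤ u y := by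
  have hsub : ∀ t ∈ Icc x y, ∀ w ∈ Icc x t, w ∈ Icc x y :=
    fun t ht w hw => ⟨hw.1, hw.2.trans ht.2⟩
  have h1 : ∀ t ∈ Icc x y, r ≤ u' t := fun t ht => by
    rw [← hr]
    exact le_of_hasDerivAt_nonneg ht.1 (fun w hw => hu' w (hsub t ht w hw)) fun w hw =>
      (mul_nonneg (by positivity) (hpos w (hsub t ht w hw))).trans (hconv w (hsub t ht w hw))
  have h2 : ∀ t ∈ Icc x y, r * (t - x) ≤ u t := fun t ht => by
    have := le_of_hasDerivAt_nonneg (φ := fun w => u w - r * (w - x)) (φ' := fun w => u' w - r * 1)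
      ht.1 (fun w hw => (hu w (hsub t ht w hw)).sub
        (((hasDerivAt_id w).sub_const x).const_mul r))
      (fun w hw => by linarith [h1 w (hsub t ht w hw)])
    simp only [sub_self, mul_zero, hux] at this
    linarith
  have h3 : ∀ t ∈ Icc x y, r + 3 * s * r * (t - x) ^ 2 ≤ u' t := fun t ht => by
    have := le_of_hasDerivAt_nonneg (φ := fun w => u' w - 3 * s * r * (w - x) ^ 2)
      (φ' := fun w => u'' w - 3 * s * r * (((2 : ℕ) : ℝ) * (w - x) ^ 1 * 1))
      ht.1 (fun w hw => (hu' w (hsub t ht w hw)).sub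
        ((((hasDerivAt_id w).sub_const x).pow 2).const_mul _))
      (fun w hw => by
        have a1 := hconv w (hsub t ht w hw)
        have a2 := mul_le_mul_of_nonneg_left (h2 w (hsub t ht w hw)) hs
        push_cast
        nlinarith)
    simp only [sub_self, hr] at this
    linarith
  have := le_of_hasDerivAt_nonneg (φ := fun w => u w - r * ((w - x) + s * (w - x) ^ 3))
    (φ' := fun w => u' w - r * (1 + s * (((3 : ℕ) : ℝ) * (w - x) ^ 2 * 1)))
    hxy (fun w hw => (hu w hw).sub
      ((((hasDerivAt_id w).sub_const x).add
        ((((hasDerivAt_id w).sub_const x).pow 3).const_mul s)).const_mul r))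
    (fun w hw => by
      have := h3 w hw
      push_cast
      nlinarith)
  simp only [sub_self, hux] at this
  linarith

/-- If `F' = g > 0`, `g' = n g` and the Schwarzian derivative `n' - n² / 2` of `F` is at most
`-12s` on `[x, y]`, then `F'(x) F'(y) / (F(y) - F(x))² ≤ 1 / (y - x)² - s`. -/
lemma deriv_mul_deriv_div_sq_le {F g n n' : ℝ → ℝ} {x y s : ℝ} (hxy : x < y) (hs : 0 ≤ s)
    (hsmall : s * (y - x) ^ 2 ≤ 1 / 2)
    (hg : ∀ t ∈ Icc x y, 0 < g t)
    (hF : ∀ t ∈ Icc x y, HasDerivAt F (g t) t)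
    (hg' : ∀ t ∈ Icc x y, HasDerivAt g (n t * g t) t)
    (hn : ∀ t ∈ Icc x y, HasDerivAt n (n' t) t)
    (hS : ∀ t ∈ Icc x y, n' t - n t ^ 2 / 2 ≤ -(12 * s)) :
    g x * g y / (F y - F x) ^ 2 ≤ 1 / (y - x) ^ 2 - s := by
  have hxm : x ∈ Icc x y := left_mem_Icc.2 hxy.le
  have hym : y ∈ Icc x y := right_mem_Icc.2 hxy.le
  have hF0 : ∀ t ∈ Icc x y, 0 ≤ F t - F x := fun t ht => sub_nonneg.2 <|
    le_of_hasDerivAt_nonneg ht.1 (fun w hw => hF w ⟨hw.1, hw.2.trans ht.2⟩)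
      (fun w hw => (hg w ⟨hw.1, hw.2.trans ht.2⟩).le)
  set v : ℝ → ℝ := fun t => (√(g t))⁻¹ with hv
  have hvd : ∀ t ∈ Icc x y, HasDerivAt v (-(n t / 2) * v t) t := fun t ht => by
    have hq := Real.sqrt_pos.2 (hg t ht)
    refine (((hg' t ht).sqrt (hg t ht).ne').inv hq.ne').congr_deriv ?_
    rw [Real.sq_sqrt (hg t ht).le, hv]
    have := (hg t ht).ne'
    field_simp
  have hgv : ∀ t ∈ Icc x y, g t * v t = √(g t) := fun t ht => by
    rw [hv]; exact Real.div_sqrt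
  have key := cubic_le_of_second_deriv (u := fun t => (F t - F x) * v t)
    (u' := fun t => g t * v t + (F t - F x) * (-(n t / 2) * v t))
    (u'' := fun t => (F t - F x) * ((n t ^ 2 / 4 - n' t / 2) * v t)) (r := √(g x)) (s := s)
    hxy.le hs (by simp [hgv x hxm]) (by simp)
    (fun t ht => ((hF t ht).sub_const _).mul (hvd t ht))
    (fun t ht => by
      refine (((hg' t ht).mul (hvd t ht)).add (((hF t ht).sub_const (F x)).mul
        (((hn t ht).div_const 2).neg.mul (hvd t ht)))).congr_deriv ?_
      dsimp
      ring)
    (fun t ht => mul_nonneg (hF0 t ht) (by positivity))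
    (fun t ht => by
      have h1 : 0 ≤ (F t - F x) * v t := mul_nonneg (hF0 t ht) (by positivity)
      have h2 := hS t ht
      nlinarith)
  have hgx := hg x hxm
  have hgy := hg y hym
  have hh : 0 < y - x := sub_pos.2 hxy
  have hgx' := Real.sqrt_pos.2 hgx
  have hgy' := Real.sqrt_pos.2 hgy
  simp only [hv] at key
  rw [← div_eq_mul_inv, le_div_iff₀ hgy'] at key
  set h := y - x with hdef
  have hpos : 0 < √(g x) * (h + s * h ^ 3) * √(g y) := by positivity
  have hsq : g x * g y * (h + s * h ^ 3) ^ 2 ≤ (F y - F x) ^ 2 := by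
    calc g x * g y * (h + s * h ^ 3) ^ 2
        = (√(g x) * (h + s * h ^ 3) * √(g y)) ^ 2 := by
          rw [mul_pow, mul_pow, Real.sq_sqrt hgx.le, Real.sq_sqrt hgy.le]; ring
      _ ≤ _ := pow_le_pow_left₀ hpos.le key 2
  have hFpos : 0 < F y - F x := hpos.trans_le key
  have hgg := mul_pos hgx hgy
  have hfac : 1 ≤ (h + s * h ^ 3) ^ 2 * (1 / h ^ 2 - s) := by
    have : (h + s * h ^ 3) ^ 2 * (1 / h ^ 2 - s) = (1 + s * h ^ 2) ^ 2 * (1 - s * h ^ 2) := by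
      field_simp
    rw [this]
    have h0 : 0 ≤ s * h ^ 2 := by positivity
    generalize s * h ^ 2 = w at *
    nlinarith [mul_nonneg h0 h0, mul_nonneg h0 (mul_nonneg h0 (sub_nonneg.2 hsmall)),
      mul_nonneg h0 (sub_nonneg.2 hsmall)]
  have hs' : 0 ≤ 1 / h ^ 2 - s := by
    rw [sub_nonneg, le_div_iff₀ (by positivity)]; linarith
  rw [div_le_iff₀ (by positivity)]
  calc g x * g y ≤ g x * g y * ((h + s * h ^ 3) ^ 2 * (1 / h ^ 2 - s)) :=
        le_mul_of_one_le_right hgg.le hfac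
    _ = (1 / h ^ 2 - s) * (g x * g y * (h + s * h ^ 3) ^ 2) := by ring
    _ ≤ _ := mul_le_mul_of_nonneg_left hsq hs'

/-- Integrated form of `deriv_mul_deriv_div_sq_le`: the cross-ratio
`|T||J| / (|L ∪ J||J ∪ R|)` increases by a factor at least `1 + s|L||R|`. -/
lemma joined_crossRatio_increase {F g n n' : ℝ → ℝ} {t1 j1 j2 t2 s : ℝ}
    (h1 : t1 < j1) (h2 : j1 < j2) (h3 : j2 < t2) (hs : 0 ≤ s)
    (hsmall : s * (t2 - t1) ^ 2 ≤ 1 / 2)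
    (hg : ∀ t ∈ Icc t1 t2, 0 < g t)
    (hF : ∀ t ∈ Icc t1 t2, HasDerivAt F (g t) t)
    (hg' : ∀ t ∈ Icc t1 t2, HasDerivAt g (n t * g t) t)
    (hn : ∀ t ∈ Icc t1 t2, HasDerivAt n (n' t) t)
    (hS : ∀ t ∈ Icc t1 t2, n' t - n t ^ 2 / 2 ≤ -(12 * s))
    (hmono : StrictMonoOn F (Icc t1 t2)) :
    (1 + s * ((j1 - t1) * (t2 - j2))) *
        (((t2 - t1) * (j2 - j1)) / ((j2 - t1) * (t2 - j1))) ≤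
      ((F t2 - F t1) * (F j2 - F j1)) / ((F j2 - F t1) * (F t2 - F j1)) := by
  have hlt : ∀ x y, t1 ≤ x → x < y → y ≤ t2 → 0 < F y - F x := fun x y hx hxy hy =>
    sub_pos.2 (hmono ⟨hx, hxy.le.trans hy⟩ ⟨hx.trans hxy.le, hy⟩ hxy)
  have hK : ∀ x y, t1 ≤ x → x < y → y ≤ t2 →
      g x * g y / (F y - F x) ^ 2 ≤ 1 / (y - x) ^ 2 - s := fun x y hx hxy hy => by
    have hsub : ∀ t ∈ Icc x y, t ∈ Icc t1 t2 := fun t ht => ⟨hx.trans ht.1, ht.2.trans hy⟩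
    refine deriv_mul_deriv_div_sq_le hxy hs ?_ (fun t ht => hg t (hsub t ht))
      (fun t ht => hF t (hsub t ht)) (fun t ht => hg' t (hsub t ht))
      (fun t ht => hn t (hsub t ht)) (fun t ht => hS t (hsub t ht))
    refine le_trans (mul_le_mul_of_nonneg_left ?_ hs) hsmall
    exact pow_le_pow_left₀ (by linarith) (by linarith) 2
  have hR : ∀ y ∈ Icc j2 t2, s * (j1 - t1) ≤
      (g y / (F y - F t1) - 1 / (y - t1)) - (g y / (F y - F j1) - 1 / (y - j1)) := fun y hy => by
    have := le_of_hasDerivAt_nonneg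
      (φ := fun x => -(g y / (F y - F x) - 1 / (y - x)) - s * x)
      (φ' := fun x => -(g x * g y / (F y - F x) ^ 2 - 1 / (y - x) ^ 2) - s * 1) h1.le
      (fun x hx => by
        have hxy : x < y := by linarith [hx.2, hy.1]
        have a1 := (hlt x y hx.1 hxy hy.2).ne'
        have a2 := (sub_pos.2 hxy).ne'
        refine (HasDerivAt.neg ?_).sub ((hasDerivAt_id x).const_mul s)
        refine (((hasDerivAt_const x (g y)).div
          ((hF x ⟨hx.1, hxy.le.trans hy.2⟩).const_sub (F y)) a1).sub
          ((hasDerivAt_const x (1 : ℝ)).div ((hasDerivAt_id x).const_sub y) a2)).congr_deriv ?_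
        simp only [id]
        ring)
      (fun x hx => by
        have := hK x y hx.1 (by linarith [hx.2, hy.1]) hy.2
        linarith)
    linarith
  have hlog := le_of_hasDerivAt_nonneg
    (φ := fun y => (Real.log (F y - F t1) - Real.log (y - t1)) -
      (Real.log (F y - F j1) - Real.log (y - j1)) - s * (j1 - t1) * y)
    (φ' := fun y => (g y / (F y - F t1) - 1 / (y - t1)) -
      (g y / (F y - F j1) - 1 / (y - j1)) - s * (j1 - t1) * 1) h3.le
    (fun y hy => by
      have hym : y ∈ Icc t1 t2 := ⟨by linarith [hy.1], hy.2⟩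
      have b1 := (hlt t1 y le_rfl (by linarith [hy.1]) hy.2).ne'
      have b2 := (hlt j1 y h1.le (by linarith [hy.1]) hy.2).ne'
      have b3 : y - t1 ≠ 0 := sub_ne_zero.2 (by linarith [hy.1] : t1 < y).ne'
      have b4 : y - j1 ≠ 0 := sub_ne_zero.2 (by linarith [hy.1] : j1 < y).ne'
      exact (((((hF y hym).sub_const _).log b1).sub
        (((hasDerivAt_id y).sub_const t1).log b3)).sub
        ((((hF y hym).sub_const _).log b2).sub
        (((hasDerivAt_id y).sub_const j1).log b4))).sub
        ((hasDerivAt_id y).const_mul _))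
    (fun y hy => by linarith [hR y hy])
  have c1 := hlt t1 t2 le_rfl (by linarith) le_rfl
  have c2 := hlt j1 j2 h1.le h2 h3.le
  have c3 := hlt t1 j2 le_rfl (by linarith) h3.le
  have c4 := hlt j1 t2 h1.le (by linarith) le_rfl
  have d1 : 0 < t2 - t1 := by linarith
  have d2 : 0 < j2 - j1 := by linarith
  have d3 : 0 < j2 - t1 := by linarith
  have d4 : 0 < t2 - j1 := by linarith
  set P := ((F t2 - F t1) * (F j2 - F j1)) / ((F j2 - F t1) * (F t2 - F j1)) with hP
  set Q := ((t2 - t1) * (j2 - j1)) / ((j2 - t1) * (t2 - j1)) with hQ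
  have hPpos : 0 < P := by positivity
  have hQpos : 0 < Q := by positivity
  have hPl : Real.log P = Real.log (F t2 - F t1) + Real.log (F j2 - F j1) -
      (Real.log (F j2 - F t1) + Real.log (F t2 - F j1)) := by
    rw [hP, Real.log_div (by positivity) (by positivity), Real.log_mul c1.ne' c2.ne',
      Real.log_mul c3.ne' c4.ne']
  have hQl : Real.log Q = Real.log (t2 - t1) + Real.log (j2 - j1) -
      (Real.log (j2 - t1) + Real.log (t2 - j1)) := by
    rw [hQ, Real.log_div (by positivity) (by positivity), Real.log_mul d1.ne' d2.ne',
      Real.log_mul d3.ne' d4.ne']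
  have hPQ : s * ((j1 - t1) * (t2 - j2)) ≤ Real.log (P / Q) := by
    rw [Real.log_div hPpos.ne' hQpos.ne', hPl, hQl]
    linarith
  rw [← le_div_iff₀ hQpos]
  have := Real.add_one_le_exp (s * ((j1 - t1) * (t2 - j2)))
  have h' := (Real.exp_le_exp.2 hPQ).trans_eq (Real.exp_log (by positivity))
  linarith

/-- Passing from `|T||J| / (|L ∪ J||J ∪ R|)` to `|T||J| / (|L||R|)`. -/
lemma crDist_ge_of_joined {F : ℝ → ℝ} {t1 j1 j2 t2 s : ℝ}
    (h1 : t1 < j1) (h2 : j1 < j2) (h3 : j2 < t2) (hs : 0 ≤ s)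
    (hmono : StrictMonoOn F (Icc t1 t2))
    (h : (1 + s * ((j1 - t1) * (t2 - j2))) *
        (((t2 - t1) * (j2 - j1)) / ((j2 - t1) * (t2 - j1))) ≤
      ((F t2 - F t1) * (F j2 - F j1)) / ((F j2 - F t1) * (F t2 - F j1))) :
    1 + s * ((j2 - t1) * (t2 - j1)) ≤ crDist F t1 j1 j2 t2 := by
  have e1 := hmono ⟨le_rfl, by linarith⟩ ⟨h1.le, by linarith⟩ h1
  have e2 := hmono ⟨h1.le, by linarith⟩ ⟨by linarith, h3.le⟩ h2
  have e3 := hmono ⟨by linarith, h3.le⟩ ⟨by linarith, le_rfl⟩ h3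
  unfold crDist crossRatio
  generalize F t1 = T1 at *
  generalize F t2 = T2 at *
  generalize F j1 = J1 at *
  generalize F j2 = J2 at *
  obtain ⟨l, rfl⟩ : ∃ l, t1 = j1 - l := ⟨j1 - t1, by ring⟩
  obtain ⟨m, rfl⟩ : ∃ m, j2 = j1 + m := ⟨j2 - j1, by ring⟩
  obtain ⟨r, rfl⟩ : ∃ r, t2 = j1 + m + r := ⟨t2 - (j1 + m), by ring⟩
  obtain ⟨L, rfl⟩ : ∃ L, T1 = J1 - L := ⟨J1 - T1, by ring⟩
  obtain ⟨M, rfl⟩ : ∃ M, J2 = J1 + M := ⟨J2 - J1, by ring⟩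
  obtain ⟨R, rfl⟩ : ∃ R, T2 = J1 + M + R := ⟨T2 - (J1 + M), by ring⟩
  have l0 : 0 < l := by linarith
  have m0 : 0 < m := by linarith
  have r0 : 0 < r := by linarith
  have L0 : 0 < L := by linarith
  have M0 : 0 < M := by linarith
  have R0 : 0 < R := by linarith
  obtain ⟨p, hp⟩ : ∃ p, p = (l + m + r) * m := ⟨_, rfl⟩
  obtain ⟨q, hq⟩ : ∃ q, q = l * r := ⟨_, rfl⟩
  obtain ⟨P, hP⟩ : ∃ P, P = (L + M + R) * M := ⟨_, rfl⟩
  obtain ⟨Q, hQ⟩ : ∃ Q, Q = L * R := ⟨_, rfl⟩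
  have p0 : 0 < p := by rw [hp]; positivity
  have q0 : 0 < q := by rw [hq]; positivity
  have P0 : 0 < P := by rw [hP]; positivity
  have Q0 : 0 < Q := by rw [hQ]; positivity
  have hl : (1 + s * q) * (p / (p + q)) ≤ P / (P + Q) := by
    convert h using 2
    · rw [hq]; ring
    · congr 1
      · rw [hp]; ring
      · rw [hp, hq]; ring
    · rw [hP]; ring
    · rw [hP, hQ]; ring
  have hgoal : 1 + s * (p + q) ≤ P / Q / (p / q) := by
    rw [← mul_div_assoc, div_le_div_iff₀ (by positivity) (by positivity)] at hl
    rw [div_div_div_eq, le_div_iff₀ (by positivity)]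
    have k1 : 0 ≤ s * q * p * (P + Q) := by positivity
    have k2 : p * Q ≤ P * q := by nlinarith
    have k3 := mul_le_mul_of_nonneg_left k2 (mul_nonneg hs p0.le)
    nlinarith
  convert hgoal using 2
  · rw [hp, hq]; ring
  · congr 1
    · rw [hP]; ring
    · rw [hQ]; ring
  · congr 1
    · rw [hp]; ring
    · rw [hq]; ring

lemma slen_Icc_inter_Icc (a b c d : ℝ) (h : max a c ≤ min b d) :
    slen (Icc a b ∩ Icc c d) = min b d - max a c := by
  rw [slen, Icc_inter_Icc, Real.volume_Icc]
  exact ENNReal.toReal_ofReal (sub_nonneg.2 h)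

/-- Under the smallness of `T ∩ E`, a pair `a ± i b` of roots contributes at most
`32 κ² / (λ² |T|²)` to the Schwarzian derivative. -/
lemma pair_contribution_lower {a b t1 t2 x lam κ : ℝ} (hb : 0 < b) (hx : x ∈ Icc t1 t2)
    (ht : t1 < t2) (hlam : 1 < lam) (hκ0 : 0 < κ) (hκ : κ < 1 / 13)
    (hcap : slen (Icc t1 t2 ∩ Icc (a - 2 * b) (a + 2 * b)) < κ * (4 * b) / lam) :
    -(32 * κ ^ 2 / lam ^ 2 / (t2 - t1) ^ 2) ≤
      2 * ((x - a) ^ 2 - b ^ 2) / ((x - a) ^ 2 + b ^ 2) ^ 2 := by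
  obtain ⟨hx1, hx2⟩ := hx
  have hτ : 0 < t2 - t1 := sub_pos.2 ht
  have hl0 : 0 < lam := by linarith
  by_cases hxb : b ^ 2 ≤ (x - a) ^ 2
  · have h1 : 0 ≤ 32 * κ ^ 2 / lam ^ 2 / (t2 - t1) ^ 2 := by positivity
    have h2 : 0 ≤ 2 * ((x - a) ^ 2 - b ^ 2) / ((x - a) ^ 2 + b ^ 2) ^ 2 :=
      div_nonneg (by linarith) (by positivity)
    linarith
  · obtain ⟨hl, hr⟩ := abs_lt.1 (abs_lt_of_sq_lt_sq (not_le.1 hxb) hb.le)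
    have hmx : max t1 (a - 2 * b) ≤ x := max_le hx1 (by linarith)
    have hxm : x ≤ min t2 (a + 2 * b) := le_min hx2 (by linarith)
    rw [slen_Icc_inter_Icc _ _ _ _ (hmx.trans hxm)] at hcap
    have hkb : κ * (4 * b) / lam < b := by
      rw [div_lt_iff₀ hl0]; nlinarith
    have hr2 : t2 < a + 2 * b := by
      by_contra h
      rw [min_eq_right (not_lt.1 h)] at hcap
      linarith
    have hl2 : a - 2 * b < t1 := by
      by_contra h
      rw [max_eq_right (not_lt.1 h)] at hcap
      linarith
    rw [min_eq_left hr2.le, max_eq_left hl2.le] at hcap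
    have hsq : lam ^ 2 * (t2 - t1) ^ 2 ≤ 16 * κ ^ 2 * b ^ 2 := by
      rw [lt_div_iff₀ hl0] at hcap
      have := pow_le_pow_left₀ (by positivity) hcap.le 2
      linarith
    have h1 : -(32 * κ ^ 2 / lam ^ 2 / (t2 - t1) ^ 2) ≤ -(2 / b ^ 2) := by
      rw [neg_le_neg_iff, div_div, div_le_div_iff₀ (by positivity) (by positivity)]
      linarith
    refine h1.trans ?_
    rw [neg_le_iff_add_nonneg, div_add_div _ _ (by positivity) (by positivity)]
    refine div_nonneg ?_ (by positivity)
    nlinarith [sq_nonneg (x - a), sq_nonneg ((x - a) ^ 2), sq_nonneg b,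
      mul_nonneg (sq_nonneg (x - a)) (sq_nonneg b)]

lemma pair_bound_aux {y b M : ℝ} (hb : 0 < b) (hM : 4 * b ≤ M) (hy : 22 / 13 * b ≤ y)
    (hyM : y ≤ 2 * b + M / 2) :
    16 * (y ^ 2 + b ^ 2) ^ 2 ≤ 34 * (y ^ 2 - b ^ 2) * M ^ 2 := by
  have hy0 : 0 < y := by linarith
  have hb2 : 0 < b ^ 2 := by positivity
  have hM2 : 16 * b ^ 2 ≤ M ^ 2 := by nlinarith
  have hyb : 484 / 169 * b ^ 2 ≤ y ^ 2 := by nlinarith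
  have hyM2 : y ^ 2 ≤ M ^ 2 := by nlinarith
  rcases le_total (y ^ 2) (3 * b ^ 2) with h | h
  · have h1 : (y ^ 2 - b ^ 2) * (16 * b ^ 2) ≤ (y ^ 2 - b ^ 2) * M ^ 2 :=
      mul_le_mul_of_nonneg_left hM2 (by linarith)
    nlinarith
  · have h1 : (y ^ 2 - b ^ 2) * (16 * (y ^ 2 + b ^ 2)) ≤ (y ^ 2 - b ^ 2) * (17 * M ^ 2) :=
      mul_le_mul_of_nonneg_left (by linarith) (by linarith)
    nlinarith

/-- The pair of roots defining the nearby critical interval contributes a definite negative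
amount to the Schwarzian derivative. -/
lemma pair_contribution_near {a b t1 t2 x lam κ : ℝ} (hb : 0 < b) (hx : x ∈ Icc t1 t2)
    (ht : t1 < t2) (hlam : 1 < lam) (hκ0 : 0 < κ) (hκ : κ < 1 / 13)
    (hcap : slen (Icc t1 t2 ∩ Icc (a - 2 * b) (a + 2 * b)) < κ * (4 * b) / lam)
    (hT : ¬ Icc t1 t2 ⊆ Icc (a - 4 * b) (a + 4 * b))
    (hE : (scaledIcc lam t1 t2 ∩ Icc (a - 2 * b) (a + 2 * b)).Nonempty) :
    16 / (17 * (1 + lam) ^ 2) / (t2 - t1) ^ 2 ≤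
      2 * ((x - a) ^ 2 - b ^ 2) / ((x - a) ^ 2 + b ^ 2) ^ 2 := by
  obtain ⟨hx1, hx2⟩ := hx
  obtain ⟨p, ⟨hp1, hp2⟩, hp3, hp4⟩ := hE
  have hτ : 0 < t2 - t1 := sub_pos.2 ht
  have hl0 : 0 < lam := by linarith
  have hkb : κ * (4 * b) / lam < 4 / 13 * b := by
    rw [div_lt_iff₀ hl0]; nlinarith
  have hout : t1 < a - 4 * b ∨ a + 4 * b < t2 := by
    by_contra! h
    exact hT (Icc_subset_Icc h.1 h.2)
  have main : 16 * ((x - a) ^ 2 + b ^ 2) ^ 2 ≤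
      34 * ((x - a) ^ 2 - b ^ 2) * ((1 + lam) * (t2 - t1)) ^ 2 := by
    have hfar : 22 / 13 * b ≤ |x - a| := by
      by_contra! h
      obtain ⟨hl, hr⟩ := abs_lt.1 h
      have hmx : max t1 (a - 2 * b) ≤ x := max_le hx1 (by linarith)
      have hxm : x ≤ min t2 (a + 2 * b) := le_min hx2 (by linarith)
      rw [slen_Icc_inter_Icc _ _ _ _ (hmx.trans hxm)] at hcap
      rcases hout with h | h
      · rw [max_eq_right (by linarith)] at hcap
        linarith
      · rw [min_eq_right (by linarith)] at hcap
        linarith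
    rw [← sq_abs (x - a)]
    refine pair_bound_aux hb ?_ hfar (abs_le.2 ⟨?_, ?_⟩)
    · rcases hout with h | h <;> linarith
    · linarith
    · linarith
  rw [div_div, div_le_div_iff₀ (by positivity)]
  · linarith
  · have : 0 < |x - a| ^ 2 + b ^ 2 := by positivity
    rw [sq_abs] at this
    positivity

/-- A real critical point in `λT` contributes a definite negative amount. -/
lemma real_contribution_near {c t1 t2 x lam : ℝ} (hx : x ∈ Icc t1 t2) (hxc : x ≠ c)
    (ht : t1 < t2) (hlam : 1 < lam) (hc : c ∈ scaledIcc lam t1 t2) :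
    16 / (17 * (1 + lam) ^ 2) / (t2 - t1) ^ 2 ≤ 1 / (x - c) ^ 2 := by
  obtain ⟨hx1, hx2⟩ := hx
  obtain ⟨hc1, hc2⟩ := hc
  have hτ : 0 < t2 - t1 := sub_pos.2 ht
  have hxc' : 0 < (x - c) ^ 2 := by have := sub_ne_zero.2 hxc; positivity
  have h : |x - c| ≤ (1 + lam) * (t2 - t1) / 2 := abs_le.2 ⟨by linarith, by linarith⟩
  have h2 := pow_le_pow_left₀ (abs_nonneg _) h 2
  rw [sq_abs] at h2
  rw [div_div, div_le_div_iff₀ (by positivity) hxc']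
  nlinarith

lemma hasDerivAt_sum_inv_sub (m : Multiset ℂ) (x : ℝ) (hx : ∀ z ∈ m, (x : ℂ) ≠ z) :
    HasDerivAt (fun t : ℝ => (m.map fun z => 1 / ((t : ℂ) - z)).sum.re)
      (-(m.map fun z => (1 / ((x : ℂ) - z) ^ 2).re).sum) x := by
  induction m using Multiset.induction_on with
  | empty => simpa using hasDerivAt_const x (0 : ℝ)
  | cons a m ih =>
    have h1 := ih fun z hz => hx z (Multiset.mem_cons_of_mem hz)
    have h2 : HasDerivAt (fun t : ℝ => (1 / ((t : ℂ) - a)).re) (-(1 / ((x : ℂ) - a) ^ 2).re) x := by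
      have ha := sub_ne_zero.2 (hx a (Multiset.mem_cons_self a m))
      have h3 : HasDerivAt (fun w : ℂ => 1 / (w - a)) (-(1 / ((x : ℂ) - a) ^ 2)) x := by
        refine ((hasDerivAt_const _ (1 : ℂ)).div ((hasDerivAt_id (x : ℂ)).sub_const a)
          ha).congr_deriv ?_
        simp only [id]
        ring
      simpa using h3.real_of_complex
    simp only [Multiset.map_cons, Multiset.sum_cons, Complex.add_re, neg_add]
    exact h2.add h1

lemma re_inv_sq_pair (x a b : ℝ) :
    (1 / ((x : ℂ) - (a + b * Complex.I)) ^ 2).re + (1 / ((x : ℂ) - (a - b * Complex.I)) ^ 2).re =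
      2 * ((x - a) ^ 2 - b ^ 2) / ((x - a) ^ 2 + b ^ 2) ^ 2 := by
  have e1 : Complex.normSq (((x : ℂ) - (a + b * Complex.I)) ^ 2) = ((x - a) ^ 2 + b ^ 2) ^ 2 := by
    rw [map_pow, Complex.normSq_apply]; simp; ring
  have e2 : Complex.normSq (((x : ℂ) - (a - b * Complex.I)) ^ 2) = ((x - a) ^ 2 + b ^ 2) ^ 2 := by
    rw [map_pow, Complex.normSq_apply]; simp; ring
  rw [one_div, one_div, Complex.inv_re, Complex.inv_re, e1, e2, ← add_div]
  congr 1
  simp [pow_two]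
  ring

/-- Lower bound for `∑ Re (x - z)⁻²` over the critical points `z`. -/
lemma sum_re_inv_sq_ge {m : Multiset ℂ} {dE : ℕ} {A B : Fin dE → ℝ} {x e K : ℝ}
    (hm : m.filter (fun z => z.im ≠ 0) =
      ↑(List.ofFn fun j : Fin dE => (A j : ℂ) + B j * Complex.I) +
      ↑(List.ofFn fun j : Fin dE => (A j : ℂ) - B j * Complex.I))
    (he : 0 ≤ e)
    (hpair : ∀ j, -e ≤ 2 * ((x - A j) ^ 2 - B j ^ 2) / ((x - A j) ^ 2 + B j ^ 2) ^ 2)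
    (hnear : (∃ c : ℝ, (c : ℂ) ∈ m ∧ K ≤ 1 / (x - c) ^ 2) ∨
      ∃ j, K ≤ 2 * ((x - A j) ^ 2 - B j ^ 2) / ((x - A j) ^ 2 + B j ^ 2) ^ 2) :
    K - dE * e ≤ (m.map fun z => (1 / ((x : ℂ) - z) ^ 2).re).sum := by
  have hsplit : (m.map fun z => (1 / ((x : ℂ) - z) ^ 2).re).sum =
      ∑ j, 2 * ((x - A j) ^ 2 - B j ^ 2) / ((x - A j) ^ 2 + B j ^ 2) ^ 2 +
      ((m.filter fun z => ¬ z.im ≠ 0).map fun z => (1 / ((x : ℂ) - z) ^ 2).re).sum := by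
    conv_lhs => rw [← Multiset.filter_add_not (fun z : ℂ => z.im ≠ 0) m]
    rw [Multiset.map_add, Multiset.sum_add, hm]
    simp only [Multiset.map_add, Multiset.sum_add, Multiset.map_coe, Multiset.sum_coe,
      List.map_ofFn, List.sum_ofFn, Function.comp_apply, ← Finset.sum_add_distrib, re_inv_sq_pair]
  have hreal : ∀ z : ℂ, z.im = 0 → (1 / ((x : ℂ) - z) ^ 2).re = 1 / (x - z.re) ^ 2 := by
    intro z hz
    obtain ⟨c, rfl⟩ : ∃ c : ℝ, z = c := ⟨z.re, Complex.ext rfl (by simpa using hz)⟩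
    rw [Complex.ofReal_re, ← Complex.ofReal_re (1 / (x - c) ^ 2)]
    push_cast
    rfl
  have hnn : ∀ r ∈ (m.filter fun z => ¬ z.im ≠ 0).map fun z => (1 / ((x : ℂ) - z) ^ 2).re,
      0 ≤ r := by
    intro r hr
    obtain ⟨z, hz, rfl⟩ := Multiset.mem_map.1 hr
    rw [hreal z (not_not.1 (Multiset.mem_filter.1 hz).2)]
    positivity
  rw [hsplit]
  have hsum : ∑ j : Fin dE, (2 * ((x - A j) ^ 2 - B j ^ 2) / ((x - A j) ^ 2 + B j ^ 2) ^ 2 + e) =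
      ∑ j, 2 * ((x - A j) ^ 2 - B j ^ 2) / ((x - A j) ^ 2 + B j ^ 2) ^ 2 + dE * e := by
    rw [Finset.sum_add_distrib]; simp
  have hpair' : ∀ j, 0 ≤ 2 * ((x - A j) ^ 2 - B j ^ 2) / ((x - A j) ^ 2 + B j ^ 2) ^ 2 + e :=
    fun j => by linarith [hpair j]
  rcases hnear with ⟨c, hc, hK⟩ | ⟨j, hK⟩
  · have h1 := Multiset.single_le_sum hnn _ (Multiset.mem_map_of_mem _
      (Multiset.mem_filter.2 ⟨hc, by simp⟩))
    rw [hreal c (Complex.ofReal_im c), Complex.ofReal_re] at h1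
    have h2 := Finset.sum_nonneg fun j (_ : j ∈ Finset.univ) => hpair' j
    linarith
  · have h1 := Multiset.sum_nonneg hnn
    have h2 := Finset.single_le_sum (fun i (_ : i ∈ Finset.univ) => hpair' i) (Finset.mem_univ j)
    linarith

/-- The logarithmic derivative of `f'` on the real line, as a sum over the complex roots. -/
def logDerivSum (f : Polynomial ℝ) (t : ℝ) : ℝ :=
  (((f.derivative.map (algebraMap ℝ ℂ)).roots.map fun z => 1 / ((t : ℂ) - z)).sum).re

lemma eval_map_ofReal (f : Polynomial ℝ) (t : ℝ) :
    (f.map (algebraMap ℝ ℂ)).eval (t : ℂ) = ((f.eval t : ℝ) : ℂ) :=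
  Polynomial.eval_map_apply (algebraMap ℝ ℂ) t

lemma hasDerivAt_derivative_eval {f : Polynomial ℝ} {t : ℝ} (h : f.derivative.eval t ≠ 0) :
    HasDerivAt (fun x => f.derivative.eval x) (logDerivSum f t * f.derivative.eval t) t := by
  refine (f.derivative.hasDerivAt t).congr_deriv ?_
  have h' : (f.derivative.map (algebraMap ℝ ℂ)).eval (t : ℂ) ≠ 0 := by
    rw [eval_map_ofReal]; exact_mod_cast h
  have := (IsAlgClosed.splits
    (f.derivative.map (algebraMap ℝ ℂ))).eval_derivative_div_eval_of_ne_zero h'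
  rw [Polynomial.derivative_map, eval_map_ofReal, eval_map_ofReal] at this
  rw [logDerivSum, ← this, ← Complex.ofReal_div, Complex.ofReal_re, div_mul_cancel₀ _ h]

lemma crDist_neg (F : ℝ → ℝ) (t1 j1 j2 t2 : ℝ) :
    crDist (fun x => -F x) t1 j1 j2 t2 = crDist F t1 j1 j2 t2 := by
  simp only [crDist, crossRatio]
  congr 2 <;> ring

/-- If `F' = g` does not vanish on `T` and `S F ≤ -12s` there, then
`B(F, T, J) ≥ 1 + s|L ∪ J||J ∪ R|`. -/
lemma crDist_ge_of_schwarzian_le {F g n n' : ℝ → ℝ} {t1 j1 j2 t2 s : ℝ}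
    (h1 : t1 < j1) (h2 : j1 < j2) (h3 : j2 < t2) (hs : 0 ≤ s)
    (hsmall : s * (t2 - t1) ^ 2 ≤ 1 / 2)
    (hg : ∀ t ∈ Icc t1 t2, g t ≠ 0)
    (hF : ∀ t ∈ Icc t1 t2, HasDerivAt F (g t) t)
    (hg' : ∀ t ∈ Icc t1 t2, HasDerivAt g (n t * g t) t)
    (hn : ∀ t ∈ Icc t1 t2, HasDerivAt n (n' t) t)
    (hS : ∀ t ∈ Icc t1 t2, n' t - n t ^ 2 / 2 ≤ -(12 * s)) :
    1 + s * ((j2 - t1) * (t2 - j1)) ≤ crDist F t1 j1 j2 t2 := by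
  have pos : ∀ F g : ℝ → ℝ, (∀ t ∈ Icc t1 t2, 0 < g t) →
      (∀ t ∈ Icc t1 t2, HasDerivAt F (g t) t) →
      (∀ t ∈ Icc t1 t2, HasDerivAt g (n t * g t) t) →
      1 + s * ((j2 - t1) * (t2 - j1)) ≤ crDist F t1 j1 j2 t2 := fun F g hg hF hg' => by
    have hmono : StrictMonoOn F (Icc t1 t2) :=
      strictMonoOn_of_hasDerivWithinAt_pos (f' := g) (convex_Icc t1 t2)
        (fun t ht => (hF t ht).continuousAt.continuousWithinAt)
        (fun t ht => (hF t (interior_subset ht)).hasDerivWithinAt)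
        (fun t ht => hg t (interior_subset ht))
    exact crDist_ge_of_joined h1 h2 h3 hs hmono
      (joined_crossRatio_increase h1 h2 h3 hs hsmall hg hF hg' hn hS hmono)
  have hcont : ContinuousOn g (Icc t1 t2) := fun t ht => (hg' t ht).continuousAt.continuousWithinAt
  have hm : t1 ∈ Icc t1 t2 := ⟨le_rfl, by linarith⟩
  have himg := isPreconnected_Icc.image g hcont
  have hsign : ∀ t ∈ Icc t1 t2, 0 < g t1 * g t := fun t ht => by
    by_contra! h
    obtain ⟨w, hw, hw0⟩ : (0 : ℝ) ∈ g '' Icc t1 t2 := by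
      rcases mul_nonpos_iff.1 h with ⟨ha, hb⟩ | ⟨ha, hb⟩
      · exact himg.ordConnected.out (mem_image_of_mem g ht) (mem_image_of_mem g hm) ⟨hb, ha⟩
      · exact himg.ordConnected.out (mem_image_of_mem g hm) (mem_image_of_mem g ht) ⟨ha, hb⟩
    exact hg w hw hw0
  rcases (hg t1 hm).lt_or_gt with h | h
  · rw [← crDist_neg]
    exact pos _ (fun t => -g t) (fun t ht => neg_pos.2 (by nlinarith [hsign t ht]))
      (fun t ht => (hF t ht).neg) (fun t ht => (hg' t ht).neg.congr_deriv (by ring))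
  · exact pos F g (fun t ht => pos_of_mul_pos_right (hsign t ht) h.le) hF hg'

open scoped Classical in
/-- Definite cross-ratio increase near a critical point or critical
interval of a polynomial: with `E_j = [a_j - 2b_j, a_j + 2b_j]` the critical intervals,
`λ > 1`, `κ ∈ (0, 1/(13√d_E))`, `T` the `δ`-scaled neighbourhood of `J`, `f` a
diffeomorphism on `T`, `|T ∩ E_j| < κ|E_j|/λ` for all `j`, and either `λT` containing a
critical point of `f` or some `E_{j₀}` with `T ⊄ 2E_{j₀}` and `λT ∩ E_{j₀} ≠ ∅`, one has
`B(f,T,J) > 1 + (1/12)(16/(17(1+λ)²) - 32κ²d_E/λ²)/(1+2δ)²`. -/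
theorem stmt_11 (f : Polynomial ℝ) (dE : ℕ)
    (A B : Fin dE → ℝ) (hB : ∀ j, 0 < B j)
    (hroots : Multiset.filter (fun z => z.im ≠ 0)
        ((f.derivative.map (algebraMap ℝ ℂ)).roots) =
      ↑(List.ofFn fun j : Fin dE => (A j : ℂ) + B j * Complex.I) +
      ↑(List.ofFn fun j : Fin dE => (A j : ℂ) - B j * Complex.I))
    (lam κ δ : ℝ) (hlam : 1 < lam) (hκ0 : 0 < κ)
    (hκ1 : κ < 1 / (13 * Real.sqrt dE)) (hδ : 0 < δ)
    (j1 j2 t1 t2 : ℝ) (hj : j1 < j2)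
    (ht1 : t1 = (j1 + j2) / 2 - (1 + 2 * δ) * (j2 - j1) / 2)
    (ht2 : t2 = (j1 + j2) / 2 + (1 + 2 * δ) * (j2 - j1) / 2)
    (hdiffeo : ∀ x ∈ Icc t1 t2, f.derivative.eval x ≠ 0)
    (hcap : ∀ j, slen (Icc t1 t2 ∩ Icc (A j - 2 * B j) (A j + 2 * B j)) <
      κ * (4 * B j) / lam)
    (hcase : (∃ c ∈ scaledIcc lam t1 t2, f.derivative.eval c = 0) ∨
      ∃ j0 : Fin dE, ¬ Icc t1 t2 ⊆ Icc (A j0 - 4 * B j0) (A j0 + 4 * B j0) ∧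
        (scaledIcc lam t1 t2 ∩ Icc (A j0 - 2 * B j0) (A j0 + 2 * B j0)).Nonempty) :
    crDist (fun x => f.eval x) t1 j1 j2 t2 >
      1 + (1 / 12) * (16 / (17 * (1 + lam) ^ 2) - 32 * κ ^ 2 * dE / lam ^ 2) *
        (1 / (1 + 2 * δ) ^ 2) := by
  have hdE : 1 ≤ dE := by
    rcases Nat.eq_zero_or_pos dE with h | h
    · subst h
      norm_num at hκ1
      linarith
    · exact h
  have hdE' : (1 : ℝ) ≤ dE := by exact_mod_cast hdE
  have hsqrt : 1 ≤ √(dE : ℝ) := Real.one_le_sqrt.2 hdE'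
  have hκ13 : κ < 1 / 13 :=
    hκ1.trans_le (one_div_le_one_div_of_le (by norm_num) (by linarith))
  have hκd : κ ^ 2 * dE < 1 / 169 := by
    rw [lt_div_iff₀ (by positivity)] at hκ1
    have := pow_lt_pow_left₀ hκ1 (by positivity) two_ne_zero
    rw [mul_pow, mul_pow, Real.sq_sqrt (by positivity)] at this
    linarith
  set m := j2 - j1 with hm
  have hm0 : 0 < m := sub_pos.2 hj
  have hδm : 0 < δ * m := by positivity
  have hτ : t2 - t1 = (1 + 2 * δ) * m := by rw [ht1, ht2]; ring
  have hτ0 : 0 < t2 - t1 := by rw [hτ]; positivity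
  have h1 : t1 < j1 := by linarith
  have h3 : j2 < t2 := by linarith
  have ht : t1 < t2 := sub_pos.1 hτ0
  set C := 16 / (17 * (1 + lam) ^ 2) - 32 * κ ^ 2 * dE / lam ^ 2 with hC
  have hC0 : 0 < C := by
    rw [hC, sub_pos, div_lt_div_iff₀ (by positivity) (by positivity)]
    nlinarith [mul_lt_mul_of_pos_right hκd (show 0 < (1 + lam) ^ 2 by positivity)]
  have hC1 : C ≤ 1 := by
    have a1 : 0 ≤ 32 * κ ^ 2 * dE / lam ^ 2 := by positivity
    have a2 : 16 / (17 * (1 + lam) ^ 2) ≤ 1 := by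
      rw [div_le_one (by positivity)]; nlinarith
    linarith
  set s := C / 12 / (t2 - t1) ^ 2 with hs
  have hs0 : 0 < s := by positivity
  have hroot : ∀ x ∈ Icc t1 t2, ∀ z ∈ (f.derivative.map (algebraMap ℝ ℂ)).roots,
      (x : ℂ) ≠ z := by
    rintro x hx z hz rfl
    have := (Polynomial.mem_roots'.1 hz).2
    rw [Polynomial.IsRoot, eval_map_ofReal] at this
    exact hdiffeo x hx (by exact_mod_cast this)
  have hf0 : f.derivative ≠ 0 := by
    intro h
    exact hdiffeo t1 ⟨le_rfl, ht.le⟩ (by rw [h, Polynomial.eval_zero])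
  have hn : ∀ t ∈ Icc t1 t2, HasDerivAt (logDerivSum f)
      (-((f.derivative.map (algebraMap ℝ ℂ)).roots.map
        fun z => (1 / ((t : ℂ) - z) ^ 2).re).sum) t :=
    fun t ht => hasDerivAt_sum_inv_sub _ t (hroot t ht)
  have key := crDist_ge_of_schwarzian_le (F := fun x => f.eval x)
    (g := fun x => f.derivative.eval x) (n := logDerivSum f) (s := s)
    h1 hj h3 hs0.le (by rw [hs, div_mul_cancel₀ _ (by positivity)]; linarith) hdiffeo
    (fun t _ => f.hasDerivAt t)
    (fun t ht => hasDerivAt_derivative_eval (hdiffeo t ht))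
    hn
    (fun x hx => by
      have := sum_re_inv_sq_ge (x := x) (e := 32 * κ ^ 2 / lam ^ 2 / (t2 - t1) ^ 2)
        (K := 16 / (17 * (1 + lam) ^ 2) / (t2 - t1) ^ 2) hroots (by positivity)
        (fun j => pair_contribution_lower (hB j) hx ht hlam hκ0 hκ13 (hcap j))
        (by
          rcases hcase with ⟨c, hc, hc0⟩ | ⟨j0, hT, hE⟩
          · refine Or.inl ⟨c, ?_, real_contribution_near hx ?_ ht hlam hc⟩
            · rw [Polynomial.mem_roots (Polynomial.map_ne_zero hf0), Polynomial.IsRoot,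
                eval_map_ofReal, hc0, Complex.ofReal_zero]
            · rintro rfl
              exact hdiffeo x hx hc0
          · exact Or.inr ⟨j0, pair_contribution_near (hB j0) hx ht hlam hκ0 hκ13 (hcap j0) hT hE⟩)
      have hsC : 12 * s = 16 / (17 * (1 + lam) ^ 2) / (t2 - t1) ^ 2 -
          dE * (32 * κ ^ 2 / lam ^ 2 / (t2 - t1) ^ 2) := by
        rw [hs, hC]; ring
      linarith [sq_nonneg (logDerivSum f x)])
  refine lt_of_lt_of_le ?_ key
  have hsm : 1 / 12 * C * (1 / (1 + 2 * δ) ^ 2) = s * m ^ 2 := by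
    rw [hs, hτ]
    field_simp
  rw [hsm]
  have harea : m ^ 2 < (j2 - t1) * (t2 - j1) := by nlinarith
  linarith [mul_lt_mul_of_pos_left harea hs0]
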